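/- Let ρ ∈ (0,1) and m ≥ 2. There exist two measurable partitions Ω_1,...,Ω_m and Ω'_1,...,Ω'_m of ℝ^{n+1} with γ_{n+1}(Ω_i) = γ_{n+1}(Ω'_i) = a_i (for prescribed a_i > 0 summing to 1) minimizing the bilinear noise stability Σ_{i=1}^m ∫ 1_{Ω_i}(x) T_ρ 1_{Ω'_i}(x) dγ_{n+1}(x) over all such pairs of partitions. -/

import Mathlib

open MeasureTheory Real

noncomputable def gaussianDensity (n : ℕ) (x : EuclideanSpace ℝ (Fin n)) : ℝ :=
  (2 * Real.pi) ^ (-(n : ℝ) / 2) * Real.exp (-‖x‖ ^ 2 / 2)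

noncomputable def gaussianMeasure (n : ℕ) : Measure (EuclideanSpace ℝ (Fin n)) :=
  volume.withDensity (fun x => ENNReal.ofReal (gaussianDensity n x))

/-- The Ornstein-Uhlenbeck operator `T_ρ`. -/
noncomputable def ouOp (n : ℕ) (ρ : ℝ) (f : EuclideanSpace ℝ (Fin n) → ℝ)
    (x : EuclideanSpace ℝ (Fin n)) : ℝ :=
  ∫ y, f (ρ • x + Real.sqrt (1 - ρ ^ 2) • y) ∂(gaussianMeasure n)

section FractionalPartition

open Set Filter Topology
open scoped ENNReal InnerProductSpace

variable {X ι : Type*} [MeasurableSpace X] [Fintype ι]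

/-- A fractional partition of `X` with prescribed masses `a`: measurable functions that
almost everywhere take values in the standard simplex and whose coordinates have integrals `a i`. -/
structure IsFractionalPartition (μ : Measure X) (a : ι → ℝ) (f : ι → X → ℝ) : Prop where
  measurable : ∀ i, Measurable (f i)
  nonneg : ∀ i, 0 ≤ᵐ[μ] f i
  sum_eq_one : ∀ᵐ x ∂μ, ∑ i, f i x = 1
  integral_eq : ∀ i, ∫ x, f i x ∂μ = a i

namespace IsFractionalPartition

variable {μ : Measure X} {a : ι → ℝ} {f : ι → X → ℝ}

lemma mem_Icc (hf : IsFractionalPartition μ a f) (i : ι) : ∀ᵐ x ∂μ, f i x ∈ Icc (0 : ℝ) 1 := by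
  filter_upwards [ae_all_iff.2 hf.nonneg, hf.sum_eq_one] with x h0 h1
  exact ⟨h0 i, h1 ▸ Finset.single_le_sum (f := fun j => f j x) (fun j _ => h0 j)
    (Finset.mem_univ i)⟩

lemma norm_le_one (hf : IsFractionalPartition μ a f) (i : ι) : ∀ᵐ x ∂μ, ‖f i x‖ ≤ 1 := by
  filter_upwards [hf.mem_Icc i] with x hx
  rw [Real.norm_of_nonneg hx.1]
  exact hx.2

lemma memLp [IsFiniteMeasure μ] (hf : IsFractionalPartition μ a f) (p : ℝ≥0∞) (i : ι) :
    MemLp (f i) p μ :=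
  MemLp.of_bound (hf.measurable i).aestronglyMeasurable 1 (hf.norm_le_one i)

lemma integrable [IsFiniteMeasure μ] (hf : IsFractionalPartition μ a f) (i : ι) :
    Integrable (f i) μ :=
  memLp_one_iff_integrable.1 (hf.memLp 1 i)

lemma of_partition [IsFiniteMeasure μ] {Ω : ι → Set X} (ha : ∀ i, 0 < a i)
    (hΩ : ∀ i, MeasurableSet (Ω i)) (hdisj : ∀ i j, i ≠ j → Ω i ∩ Ω j = ∅)
    (hcover : ⋃ i, Ω i = univ) (hmass : ∀ i, μ (Ω i) = ENNReal.ofReal (a i)) :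
    IsFractionalPartition μ a (fun i => (Ω i).indicator fun _ => (1 : ℝ)) where
  measurable i := measurable_const.indicator (hΩ i)
  nonneg i := ae_of_all _ fun x => indicator_nonneg (fun _ _ => zero_le_one) x
  sum_eq_one := ae_of_all _ fun x => by
    obtain ⟨i, hi⟩ := mem_iUnion.1 (hcover ▸ mem_univ x)
    rw [Finset.sum_eq_single i]
    · simp [hi]
    · intro j _ hji
      refine indicator_of_notMem (fun hj => ?_) _
      exact (hdisj j i hji).le ⟨hj, hi⟩
    · simp
  integral_eq i := by
    rw [integral_indicator_const _ (hΩ i)]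
    simp [Measure.real, hmass, (ha i).le]

lemma const [IsProbabilityMeasure μ] (ha : ∀ i, 0 < a i) (hsum : ∑ i, a i = 1) :
    IsFractionalPartition μ a (fun i _ => a i) where
  measurable i := measurable_const
  nonneg i := ae_of_all _ fun _ => (ha i).le
  sum_eq_one := ae_of_all _ fun _ => hsum
  integral_eq i := by simp

end IsFractionalPartition

variable [DecidableEq ι] (μ : Measure X) [IsProbabilityMeasure μ] (a : ι → ℝ)

/-- Fractional partitions, viewed as functionals on `ι → L²(μ)`. -/
def fractionalPartitionDual : Set (WeakDual ℝ (ι → Lp ℝ 2 μ)) :=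
  {φ | (∀ i s, ∀ hs : MeasurableSet s,
          0 ≤ φ (Pi.single i (indicatorConstLp 2 hs (measure_ne_top μ s) (1 : ℝ)))) ∧
       (∀ s, ∀ hs : MeasurableSet s,
          ∑ i, φ (Pi.single i (indicatorConstLp 2 hs (measure_ne_top μ s) (1 : ℝ))) = μ.real s) ∧
       ∀ i, φ (Pi.single i
          (indicatorConstLp 2 MeasurableSet.univ (measure_ne_top μ univ) (1 : ℝ))) = a i}

variable {μ a}

lemma isClosed_fractionalPartitionDual : IsClosed (fractionalPartitionDual μ a) := by
  simp only [fractionalPartitionDual, ofPred_and, ofPred_forall]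
  refine IsClosed.inter ?_ (IsClosed.inter ?_ ?_)
  · exact isClosed_iInter fun i => isClosed_iInter fun s => isClosed_iInter fun hs =>
      isClosed_le continuous_const (WeakDual.eval_continuous _)
  · exact isClosed_iInter fun s => isClosed_iInter fun hs =>
      isClosed_eq (continuous_finsetSum _ fun i _ => WeakDual.eval_continuous _) continuous_const
  · exact isClosed_iInter fun i => isClosed_eq (WeakDual.eval_continuous _) continuous_const

lemma IsFractionalPartition.exists_dual {f : ι → X → ℝ} (hf : IsFractionalPartition μ a f) :
    ∃ φ ∈ fractionalPartitionDual μ a, ∀ v, φ v = ∑ i, ∫ x, f i x * v i x ∂μ := by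
  let L : (ι → Lp ℝ 2 μ) →L[ℝ] ℝ :=
    ∑ i, (innerSL ℝ ((hf.memLp 2 i).toLp (f i))).comp (ContinuousLinearMap.proj i)
  have hL : ∀ v, L v = ∑ i, ∫ x, f i x * v i x ∂μ := by
    intro v
    simp only [L, _root_.sum_apply, ContinuousLinearMap.comp_apply,
      ContinuousLinearMap.proj_apply, innerSL_apply_apply, L2.inner_def]
    refine Finset.sum_congr rfl fun i _ => integral_congr_ae ?_
    filter_upwards [(hf.memLp 2 i).coeFn_toLp] with x hx
    simp [hx, mul_comm]
  have hind : ∀ i s, ∀ hs : MeasurableSet s,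
      L (Pi.single i (indicatorConstLp 2 hs (measure_ne_top μ s) (1 : ℝ)))
        = ∫ x in s, f i x ∂μ := by
    intro i s hs
    simp only [L, _root_.sum_apply, ContinuousLinearMap.comp_apply,
      ContinuousLinearMap.proj_apply, innerSL_apply_apply]
    rw [Finset.sum_eq_single i]
    · rw [Pi.single_eq_same, real_inner_comm, L2.inner_indicatorConstLp_one]
      exact setIntegral_congr_ae hs ((hf.memLp 2 i).coeFn_toLp.mono fun x hx _ => hx)
    · intro j _ hj
      simp [Pi.single_eq_of_ne hj]
    · simp
  refine ⟨StrongDual.toWeakDual L, ⟨?_, ?_, ?_⟩, hL⟩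
  · intro i s hs
    rw [StrongDual.toWeakDual_apply, hind]
    exact setIntegral_nonneg_of_ae (hf.nonneg i)
  · intro s hs
    simp only [StrongDual.toWeakDual_apply, hind]
    rw [← integral_finsetSum _ fun i _ => (hf.integrable i).integrableOn,
      integral_congr_ae (ae_restrict_of_ae hf.sum_eq_one)]
    simp
  · intro i
    rw [StrongDual.toWeakDual_apply, hind, setIntegral_univ, hf.integral_eq]

lemma exists_isFractionalPartition_of_mem_dual {φ : WeakDual ℝ (ι → Lp ℝ 2 μ)}
    (hφ : φ ∈ fractionalPartitionDual μ a) :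
    ∃ f, IsFractionalPartition μ a f ∧ ∀ v, φ v = ∑ i, ∫ x, f i x * v i x ∂μ := by
  let L : ι → StrongDual ℝ (Lp ℝ 2 μ) := fun i =>
    (WeakDual.toStrongDual φ).comp (ContinuousLinearMap.single ℝ (fun _ : ι => Lp ℝ 2 μ) i)
  let g : ι → Lp ℝ 2 μ := fun i => (InnerProductSpace.toDual ℝ (Lp ℝ 2 μ)).symm (L i)
  have hg : ∀ i v, φ (Pi.single i v) = ⟪g i, v⟫_ℝ := by
    intro i v
    simp only [g, InnerProductSpace.toDual_symm_apply]
    rfl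
  have hind : ∀ i s, ∀ hs : MeasurableSet s,
      φ (Pi.single i (indicatorConstLp 2 hs (measure_ne_top μ s) (1 : ℝ)))
        = ∫ x in s, g i x ∂μ := by
    intro i s hs
    rw [hg, real_inner_comm, L2.inner_indicatorConstLp_one]
  have hint : ∀ i, Integrable (g i) μ := fun i => (Lp.memLp (g i)).integrable one_le_two
  refine ⟨fun i => g i, ⟨?_, ?_, ?_, ?_⟩, ?_⟩
  · exact fun i => (Lp.stronglyMeasurable (g i)).measurable
  · intro i
    refine ae_nonneg_of_forall_setIntegral_nonneg (hint i) fun s hs _ => ?_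
    rw [← hind i s hs]
    exact hφ.1 i s hs
  · refine Integrable.ae_eq_of_forall_setIntegral_eq _ (fun _ => (1 : ℝ))
      (integrable_finsetSum _ fun i _ => hint i) (integrable_const _) fun s hs _ => ?_
    rw [integral_finsetSum _ fun i _ => (hint i).integrableOn]
    simp only [← hind _ s hs]
    rw [hφ.2.1 s hs]
    simp
  · intro i
    rw [← hφ.2.2 i, hind, setIntegral_univ]
  · intro v
    have hv : v = ∑ i, Pi.single i (v i) := (Finset.univ_sum_single v).symm
    conv_lhs => rw [hv, map_sum]
    refine Finset.sum_congr rfl fun i _ => ?_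
    rw [hg, L2.inner_def]
    refine integral_congr_ae (ae_of_all _ fun x => ?_)
    simp [mul_comm]

lemma isBounded_fractionalPartitionDual :
    Bornology.IsBounded (fractionalPartitionDual μ a) := by
  refine (Metric.isBounded_iff_subset_closedBall (0 : StrongDual ℝ (ι → Lp ℝ 2 μ))).2
    ⟨Fintype.card ι, fun L hL => ?_⟩
  rw [mem_closedBall_zero_iff]
  refine L.opNorm_le_bound (Nat.cast_nonneg _) fun v => ?_
  obtain ⟨f, hf, hfv⟩ := exists_isFractionalPartition_of_mem_dual hL
  have hLv : L v = ∑ i, ∫ x, f i x * v i x ∂μ := hfv v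
  rw [hLv]
  calc ‖∑ i, ∫ x, f i x * v i x ∂μ‖ ≤ ∑ i, ‖∫ x, f i x * v i x ∂μ‖ := norm_sum_le _ _
    _ ≤ ∑ _i : ι, ‖v‖ := Finset.sum_le_sum fun i _ => ?_
    _ = Fintype.card ι * ‖v‖ := by simp
  have hinner : ∫ x, f i x * v i x ∂μ = ⟪(hf.memLp 2 i).toLp (f i), v i⟫_ℝ := by
    rw [L2.inner_def]
    refine integral_congr_ae ?_
    filter_upwards [(hf.memLp 2 i).coeFn_toLp] with x hx
    simp [hx, mul_comm]
  have hnorm : ‖(hf.memLp 2 i).toLp (f i)‖ ≤ 1 := by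
    have := Lp.norm_le_of_ae_bound (f := (hf.memLp 2 i).toLp (f i)) zero_le_one (by
      filter_upwards [(hf.memLp 2 i).coeFn_toLp, hf.norm_le_one i] with x hx h1
      rwa [hx])
    have huniv : measureUnivNNReal μ = 1 := by simp [measureUnivNNReal]
    rwa [huniv, NNReal.coe_one, Real.one_rpow, one_mul] at this
  rw [hinner]
  calc _ ≤ ‖(hf.memLp 2 i).toLp (f i)‖ * ‖v i‖ := norm_inner_le_norm _ _
    _ ≤ 1 * ‖v‖ := by gcongr; exact norm_le_pi_norm v i
    _ = ‖v‖ := one_mul _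

/-- Weak sequential compactness of the set of fractional partitions. -/
lemma exists_subseq_tendsto_isFractionalPartition [IsSeparable μ] {f : ℕ → ι → X → ℝ}
    (hf : ∀ k, IsFractionalPartition μ a (f k)) :
    ∃ g, IsFractionalPartition μ a g ∧ ∃ σ : ℕ → ℕ, StrictMono σ ∧
      ∀ i v, MemLp v 2 μ →
        Tendsto (fun k => ∫ x, f (σ k) i x * v x ∂μ) atTop (𝓝 (∫ x, g i x * v x ∂μ)) := by
  have : Fact ((2 : ℝ≥0∞) ≠ ∞) := ⟨by simp⟩
  choose φ hφ hφf using fun k => (hf k).exists_dual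
  obtain ⟨ψ, hψ, σ, hσ, hlim⟩ := WeakDual.isSeqCompact_of_isBounded_of_isClosed ℝ _
    isBounded_fractionalPartitionDual isClosed_fractionalPartitionDual hφ
  obtain ⟨g, hg, hψg⟩ := exists_isFractionalPartition_of_mem_dual hψ
  refine ⟨g, hg, σ, hσ, fun i v hv => ?_⟩
  have heval := ((WeakDual.eval_continuous (Pi.single i (hv.toLp v))).tendsto ψ).comp hlim
  have hsingle : ∀ u : ι → X → ℝ,
      ∑ j, ∫ x, u j x * (Pi.single i (hv.toLp v) : ι → Lp ℝ 2 μ) j x ∂μ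
        = ∫ x, u i x * v x ∂μ := by
    intro u
    rw [Finset.sum_eq_single i]
    · rw [Pi.single_eq_same]
      refine integral_congr_ae ?_
      filter_upwards [hv.coeFn_toLp] with x hx
      rw [hx]
    · intro j _ hj
      simp [Pi.single_eq_of_ne hj]
    · simp
  rw [hψg, hsingle] at heval
  refine heval.congr fun k => ?_
  simp only [Function.comp_apply, hφf, hsingle]

/-- Transferring mass `u` from the `j`-th to the `i`-th coordinate. -/
lemma IsFractionalPartition.transfer {f : ι → X → ℝ} (hf : IsFractionalPartition μ a f)
    {i j : ι} (hij : i ≠ j) {u : X → ℝ} (hu : Measurable u) (hint : ∫ x, u x ∂μ = 0)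
    (hle : ∀ᵐ x ∂μ, |u x| ≤ min (f i x) (f j x)) :
    IsFractionalPartition μ a
      (fun k x => f k x + (Pi.single i (u x) - Pi.single j (u x) : ι → ℝ) k) := by
  have hcases : ∀ k, (k = i ∧ ∀ x, (Pi.single i (u x) - Pi.single j (u x) : ι → ℝ) k = u x) ∨
      (k = j ∧ ∀ x, (Pi.single i (u x) - Pi.single j (u x) : ι → ℝ) k = - u x) ∨
      (∀ x, (Pi.single i (u x) - Pi.single j (u x) : ι → ℝ) k = 0) := by
    intro k
    by_cases hki : k = i
    · subst hki
      exact Or.inl ⟨rfl, fun x => by simp [Pi.single_eq_of_ne hij]⟩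
    · by_cases hkj : k = j
      · subst hkj
        exact Or.inr (Or.inl ⟨rfl, fun x => by simp [Pi.single_eq_of_ne hki]⟩)
      · exact Or.inr (Or.inr fun x => by
          simp [Pi.single_eq_of_ne hki, Pi.single_eq_of_ne hkj])
  have hui : Integrable u μ :=
    Integrable.mono' (hf.integrable i) hu.aestronglyMeasurable
      (hle.mono fun x hx => hx.trans (min_le_left _ _))
  refine ⟨fun k => ?_, fun k => ?_, ?_, fun k => ?_⟩
  · rcases hcases k with ⟨-, h⟩ | ⟨-, h⟩ | h <;> simp only [h]
    · exact (hf.measurable k).add hu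
    · exact (hf.measurable k).add hu.neg
    · exact (hf.measurable k).add measurable_const
  · filter_upwards [hle, hf.nonneg k] with x hx hk
    have hi := (neg_abs_le (u x)).trans' (neg_le_neg (hx.trans (min_le_left _ _)))
    have hj := (le_abs_self (u x)).trans (hx.trans (min_le_right _ _))
    simp only [Pi.zero_apply] at hk ⊢
    rcases hcases k with ⟨rfl, h⟩ | ⟨rfl, h⟩ | h <;> rw [h] <;> linarith
  · filter_upwards [hf.sum_eq_one] with x hx
    simp [Finset.sum_add_distrib, hx]
  · rcases hcases k with ⟨-, h⟩ | ⟨-, h⟩ | h <;> simp only [h]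
    · rw [integral_add (hf.integrable k) hui, hint, hf.integral_eq, add_zero]
    · rw [integral_add (hf.integrable k) hui.fun_neg, integral_neg, hint, hf.integral_eq, neg_zero,
        add_zero]
    · simp [hf.integral_eq]

/-- On a diffuse space, a fractional partition that is an extreme point has coordinates with
a.e. disjoint supports. -/
lemma ae_min_eq_zero_of_mem_extremePoints {ψ : X → ℝ} (hψ : Measurable ψ)
    (hψ01 : ∀ x, ψ x ∈ Icc (0 : ℝ) 1) (hψc : ∀ c, μ (ψ ⁻¹' {c}) = 0)
    {φ : WeakDual ℝ (ι → Lp ℝ 2 μ)} (hφ : φ ∈ (fractionalPartitionDual μ a).extremePoints ℝ)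
    {f : ι → X → ℝ} (hf : IsFractionalPartition μ a f)
    (hφf : ∀ v, φ v = ∑ i, ∫ x, f i x * v i x ∂μ) {i j : ι} (hij : i ≠ j) :
    ∀ᵐ x ∂μ, min (f i x) (f j x) = 0 := by
  set w : X → ℝ := fun x => min (f i x) (f j x) with hw
  have hwm : Measurable w := (hf.measurable i).min (hf.measurable j)
  have hw0 : 0 ≤ᵐ[μ] w := by
    filter_upwards [hf.nonneg i, hf.nonneg j] with x hi hj using le_min hi hj
  have hwle : ∀ᵐ x ∂μ, ‖w x‖ ≤ 1 := by
    filter_upwards [hw0, hf.mem_Icc i] with x h0 h1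
    rw [Real.norm_of_nonneg h0]
    exact (min_le_left _ _).trans h1.2
  have hwi : Integrable w μ := Integrable.of_bound hwm.aestronglyMeasurable 1 hwle
  rcases (integral_nonneg_of_ae hw0).eq_or_lt with hW | hW
  · exact (integral_eq_zero_iff_of_nonneg_ae hw0 hwi).1 hW.symm
  have hψwi : Integrable (fun x => ψ x * w x) μ := by
    refine hwi.bdd_mul (c := 1) hψ.aestronglyMeasurable (ae_of_all _ fun x => ?_)
    rw [Real.norm_of_nonneg (hψ01 x).1]
    exact (hψ01 x).2
  set c : ℝ := (∫ x, ψ x * w x ∂μ) / ∫ x, w x ∂μ with hc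
  have hc0 : 0 ≤ c := div_nonneg
    (integral_nonneg_of_ae (hw0.mono fun x hx => mul_nonneg (hψ01 x).1 hx)) hW.le
  have hc1 : c ≤ 1 := (div_le_one hW).2 (integral_mono_ae hψwi hwi
    (hw0.mono fun x hx => mul_le_of_le_one_left hx (hψ01 x).2))
  set u : X → ℝ := fun x => (ψ x - c) * w x with hu
  have hum : Measurable u := (hψ.sub measurable_const).mul hwm
  have huint : ∫ x, u x ∂μ = 0 := by
    simp only [hu, sub_mul]
    rw [integral_sub hψwi (hwi.const_mul c), integral_const_mul, hc, div_mul_cancel₀ _ hW.ne',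
      sub_self]
  have hule : ∀ᵐ x ∂μ, |u x| ≤ w x := by
    filter_upwards [hw0] with x hx
    rw [hu, abs_mul, abs_of_nonneg hx]
    refine mul_le_of_le_one_left hx (abs_le.2 ⟨?_, ?_⟩) <;>
      linarith [(hψ01 x).1, (hψ01 x).2]
  have hf₁ := hf.transfer hij hum huint hule
  have hf₂ := hf.transfer (u := fun x => - u x) hij hum.neg (by rw [integral_neg, huint, neg_zero])
    (by simpa only [abs_neg] using hule)
  obtain ⟨φ₁, hφ₁, hφ₁f⟩ := hf₁.exists_dual
  obtain ⟨φ₂, hφ₂, hφ₂f⟩ := hf₂.exists_dual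
  have hintegrable : ∀ {g : ι → X → ℝ}, IsFractionalPartition μ a g → ∀ (v : ι → Lp ℝ 2 μ) k,
      Integrable (fun x => g k x * v k x) μ := fun hg v k =>
    ((hg.memLp 2 k).integrable_mul (Lp.memLp (v k)))
  have hmid : φ ∈ openSegment ℝ φ₁ φ₂ := by
    refine ⟨1 / 2, 1 / 2, by norm_num, by norm_num, by norm_num, ?_⟩
    refine DFunLike.ext _ _ fun v => ?_
    change 1 / 2 * φ₁ v + 1 / 2 * φ₂ v = φ v
    rw [hφf, hφ₁f, hφ₂f, ← mul_add, ← Finset.sum_add_distrib, Finset.mul_sum]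
    refine Finset.sum_congr rfl fun k _ => ?_
    rw [← integral_add (hintegrable hf₁ v k) (hintegrable hf₂ v k), ← integral_const_mul]
    refine integral_congr_ae (ae_of_all _ fun x => ?_)
    simp only [Pi.single_neg, Pi.sub_apply, Pi.neg_apply]
    ring
  have hφeq : φ₁ = φ := ((mem_extremePoints.1 hφ).2 φ₁ hφ₁ φ₂ hφ₂ hmid).1
  have huL : MemLp u 2 μ := by
    refine MemLp.of_bound hum.aestronglyMeasurable 1 ?_
    filter_upwards [hule, hwle] with x h1 h2
    exact h1.trans ((le_abs_self _).trans h2)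
  have hsq : ∫ x, u x * u x ∂μ = 0 := by
    have heq : φ₁ (Pi.single i (huL.toLp u)) = φ (Pi.single i (huL.toLp u)) := by rw [hφeq]
    rw [hφf, hφ₁f, ← sub_eq_zero, ← Finset.sum_sub_distrib, Finset.sum_eq_single i] at heq
    · rw [← integral_sub (hintegrable hf₁ _ i) (hintegrable hf _ i)] at heq
      rw [← heq]
      refine integral_congr_ae ?_
      filter_upwards [huL.coeFn_toLp] with x hx
      simp [hx, Pi.single_eq_of_ne hij]
      ring
    · intro k _ hk
      rw [← integral_sub (hintegrable hf₁ _ k) (hintegrable hf _ k)]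
      refine integral_eq_zero_of_ae ?_
      filter_upwards with x
      simp [Pi.single_eq_of_ne hk]
    · simp
  have hu0 := (integral_eq_zero_iff_of_nonneg (fun x => mul_self_nonneg (u x))
    (huL.integrable_mul huL)).1 hsq
  have hψne : ∀ᵐ x ∂μ, ψ x ≠ c := by
    rw [ae_iff]
    convert hψc c using 2
    ext x
    simp
  filter_upwards [hu0, hψne] with x hx hne
  have hux : u x = 0 := mul_self_eq_zero.1 hx
  exact (mul_eq_zero.1 hux).resolve_left (sub_ne_zero.2 hne)

/-- Linear functionals on fractional partitions over a diffuse space do not increase when passing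
to a suitable genuine partition. -/
lemma IsFractionalPartition.exists_partition_le {f : ι → X → ℝ} (hf : IsFractionalPartition μ a f)
    {ψ : X → ℝ} (hψ : Measurable ψ)
    (hψ01 : ∀ x, ψ x ∈ Icc (0 : ℝ) 1) (hψc : ∀ c, μ (ψ ⁻¹' {c}) = 0)
    {h : ι → X → ℝ} (hh : ∀ i, MemLp (h i) 2 μ) :
    ∃ Ω : ι → Set X, (∀ i, MeasurableSet (Ω i)) ∧ (∀ i j, i ≠ j → Ω i ∩ Ω j = ∅) ∧
      ⋃ i, Ω i = univ ∧ (∀ i, μ (Ω i) = ENNReal.ofReal (a i)) ∧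
      ∑ i, ∫ x, (Ω i).indicator (fun _ => (1 : ℝ)) x * h i x ∂μ
        ≤ ∑ i, ∫ x, f i x * h i x ∂μ := by
  classical
  obtain ⟨φ₀, hφ₀, hφ₀f⟩ := hf.exists_dual
  let H : ι → Lp ℝ 2 μ := fun i => (hh i).toLp (h i)
  have hH : ∀ u : ι → X → ℝ, ∑ i, ∫ x, u i x * H i x ∂μ = ∑ i, ∫ x, u i x * h i x ∂μ := by
    intro u
    refine Finset.sum_congr rfl fun i _ => integral_congr_ae ?_
    filter_upwards [(hh i).coeFn_toLp] with x hx
    simp only [H, hx]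
  let l : StrongDual ℝ (WeakDual ℝ (ι → Lp ℝ 2 μ)) :=
    { toFun := fun φ => - φ H
      map_add' := fun φ ψ => by
        change - (φ H + ψ H) = _
        ring
      map_smul' := fun r φ => by
        change - (r * φ H) = r * (- φ H)
        ring
      cont := (WeakDual.eval_continuous H).neg }
  have hcomp : IsCompact (fractionalPartitionDual μ a) :=
    WeakDual.isCompact_of_bounded_of_closed isBounded_fractionalPartitionDual
      isClosed_fractionalPartitionDual
  have hexp := ContinuousLinearMap.toExposed.isExposed (l := l) (A := fractionalPartitionDual μ a)
  have hne : (l.toExposed (fractionalPartitionDual μ a)).Nonempty := by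
    obtain ⟨φ, hφ, hmax⟩ := hcomp.exists_isMaxOn ⟨φ₀, hφ₀⟩ l.continuous.continuousOn
    exact ⟨φ, hφ, hmax⟩
  have : LocallyConvexSpace ℝ (WeakDual ℝ (ι → Lp ℝ 2 μ)) :=
    inferInstanceAs (LocallyConvexSpace ℝ (WeakBilin (topDualPairing ℝ (ι → Lp ℝ 2 μ))))
  obtain ⟨φ, hφ⟩ := (hexp.isCompact hcomp).extremePoints_nonempty hne
  have hφmax : l φ₀ ≤ l φ := hφ.1.2 φ₀ hφ₀
  have hφext := hexp.isExtreme.extremePoints_subset_extremePoints hφ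
  obtain ⟨g, hg, hφg⟩ := exists_isFractionalPartition_of_mem_dual hφext.1
  have hle : ∑ i, ∫ x, g i x * h i x ∂μ ≤ ∑ i, ∫ x, f i x * h i x ∂μ := by
    rw [← hH, ← hH, ← hφg, ← hφ₀f]
    exact neg_le_neg_iff.1 hφmax
  have hmin : ∀ᵐ x ∂μ, ∀ i j, i ≠ j → min (g i x) (g j x) = 0 := by
    simp only [ae_all_iff]
    exact fun i j hij => ae_min_eq_zero_of_mem_extremePoints hψ hψ01 hψc hφext hg hφg hij
  have hone : ∀ᵐ x ∂μ, ∃ i, g i x = 1 ∧ ∀ j, j ≠ i → g j x = 0 := by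
    filter_upwards [hmin, ae_all_iff.2 hg.nonneg, hg.sum_eq_one] with x hx h0 h1
    obtain ⟨i, -, hi⟩ := Finset.exists_ne_zero_of_sum_ne_zero (h1.trans_ne one_ne_zero)
    have hothers : ∀ j, j ≠ i → g j x = 0 := by
      intro j hji
      rcases min_choice (g i x) (g j x) with h | h
      · exact absurd (h.symm.trans (hx i j hji.symm)) hi
      · exact h.symm.trans (hx i j hji.symm)
    refine ⟨i, ?_, hothers⟩
    rwa [Finset.sum_eq_single i (fun j _ hj => hothers j hj) (by simp)] at h1
  obtain ⟨i₀⟩ : Nonempty ι := by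
    obtain ⟨x, i, -⟩ := hone.exists
    exact ⟨i⟩
  let A : ι → Set X := fun i => {x | g i x = 1} ∩ ⋂ j, {x | j ≠ i → g j x = 0}
  have hA : ∀ i, MeasurableSet (A i) := fun i =>
    ((hg.measurable i) (measurableSet_singleton 1)).inter <| MeasurableSet.iInter fun j => by
      by_cases hji : j = i
      · simp [hji]
      · have heq : {x | j ≠ i → g j x = 0} = g j ⁻¹' {0} := by
          ext x
          simp [hji]
        exact heq ▸ hg.measurable j (measurableSet_singleton 0)
  have hmemA : ∀ i x, x ∈ A i ↔ g i x = 1 ∧ ∀ j, j ≠ i → g j x = 0 := by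
    intro i x
    simp [A]
  have hAdisj : ∀ i j, i ≠ j → A i ∩ A j = ∅ := by
    intro i j hij
    refine eq_empty_of_forall_notMem fun x hx => ?_
    have h1 := ((hmemA i x).1 hx.1).1
    have h2 := ((hmemA j x).1 hx.2).2 i hij
    exact one_ne_zero (h1.symm.trans h2)
  let Ω : ι → Set X := fun i => if i = i₀ then A i ∪ (⋃ k, A k)ᶜ else A i
  have hAΩ : ∀ i, A i ⊆ Ω i := by
    intro i
    by_cases hi : i = i₀ <;> simp [Ω, hi]
  have hΩA : ∀ i x, x ∈ Ω i → x ∈ A i ∨ (i = i₀ ∧ ∀ k, x ∉ A k) := by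
    intro i x hx
    by_cases hi : i = i₀
    · simpa [Ω, hi] using hx
    · exact Or.inl (by simpa [Ω, hi] using hx)
  have hΩm : ∀ i, MeasurableSet (Ω i) := by
    intro i
    by_cases hi : i = i₀
    · simpa [Ω, hi] using (hA i₀).union (MeasurableSet.iUnion hA).compl
    · simpa [Ω, hi] using hA i
  have hgΩ : ∀ i, (Ω i).indicator (fun _ => (1 : ℝ)) =ᵐ[μ] g i := by
    intro i
    filter_upwards [hone] with x ⟨k, hk⟩
    have hxk : x ∈ A k := (hmemA k x).2 hk
    by_cases hik : i = k
    · subst hik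
      rw [indicator_of_mem (hAΩ _ hxk), hk.1]
    · rw [hk.2 i hik, indicator_of_notMem]
      intro hx
      rcases hΩA i x hx with h | h
      · exact (hAdisj i k hik).le ⟨h, hxk⟩
      · exact h.2 k hxk
  refine ⟨Ω, hΩm, ?_, ?_, ?_, ?_⟩
  · intro i j hij
    refine eq_empty_of_forall_notMem fun x hx => ?_
    rcases hΩA i x hx.1 with h | h <;> rcases hΩA j x hx.2 with h' | h'
    · exact (hAdisj i j hij).le ⟨h, h'⟩
    · exact h'.2 i h
    · exact h.2 j h'
    · exact hij (h.1.trans h'.1.symm)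
  · refine eq_univ_of_forall fun x => mem_iUnion.2 ?_
    by_cases hx : ∃ k, x ∈ A k
    · obtain ⟨k, hk⟩ := hx
      exact ⟨k, hAΩ k hk⟩
    · push Not at hx
      exact ⟨i₀, by simp [Ω, hx]⟩
  · intro i
    have := integral_congr_ae (hgΩ i)
    rw [hg.integral_eq, integral_indicator_const _ (hΩm i), smul_eq_mul, mul_one] at this
    rw [← this, ofReal_measureReal]
  · refine le_of_eq_of_le (Finset.sum_congr rfl fun i _ => integral_congr_ae ?_) hle
    filter_upwards [hgΩ i] with x hx
    rw [hx]

end FractionalPartition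

section SymmetricMarkovDensity

open Set Filter Topology
open scoped ENNReal

variable {X ι : Type*} [MeasurableSpace X] [Fintype ι]

/-- A square-integrable symmetric Markov transition density with respect to `μ`. -/
structure IsSymmMarkovDensity (μ : Measure X) (K : X → X → ℝ) : Prop where
  measurable : Measurable (Function.uncurry K)
  nonneg : ∀ x y, 0 ≤ K x y
  symm : ∀ x y, K x y = K y x
  memLp : ∀ x, MemLp (K x) 2 μ
  integral_eq_one : ∀ x, ∫ y, K x y ∂μ = 1

namespace IsSymmMarkovDensity

variable {μ : Measure X} [IsProbabilityMeasure μ] {K : X → X → ℝ} {a : ι → ℝ}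

lemma integrable (hK : IsSymmMarkovDensity μ K) (x : X) : Integrable (K x) μ :=
  (hK.memLp x).integrable one_le_two

lemma measurable_integral (hK : IsSymmMarkovDensity μ K) {f : X → ℝ} (hf : Measurable f) :
    Measurable fun x => ∫ y, f y * K x y ∂μ :=
  (((hf.comp measurable_snd).mul hK.measurable).stronglyMeasurable.integral_prod_right).measurable

lemma norm_integral_le_one (hK : IsSymmMarkovDensity μ K) {f : X → ℝ}
    (hf : ∀ᵐ x ∂μ, ‖f x‖ ≤ 1) (x : X) : ‖∫ y, f y * K x y ∂μ‖ ≤ 1 := by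
  rw [← hK.integral_eq_one x]
  refine norm_integral_le_of_norm_le (hK.integrable x) ?_
  filter_upwards [hf] with y hy
  rw [norm_mul, Real.norm_of_nonneg (hK.nonneg x y)]
  exact mul_le_of_le_one_left (hK.nonneg x y) hy

lemma memLp_integral (hK : IsSymmMarkovDensity μ K) {f : X → ℝ} (hfm : Measurable f)
    (hf : ∀ᵐ x ∂μ, ‖f x‖ ≤ 1) (p : ℝ≥0∞) : MemLp (fun x => ∫ y, f y * K x y ∂μ) p μ :=
  MemLp.of_bound (hK.measurable_integral hfm).aestronglyMeasurable 1
    (ae_of_all _ (hK.norm_integral_le_one hf))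

lemma integrable_uncurry (hK : IsSymmMarkovDensity μ K) :
    Integrable (Function.uncurry K) (μ.prod μ) := by
  refine (integrable_prod_iff hK.measurable.aestronglyMeasurable).2
    ⟨ae_of_all _ hK.integrable, ?_⟩
  simp [Function.uncurry, abs_of_nonneg (hK.nonneg _ _), hK.integral_eq_one]

/-- The bilinear form of a symmetric density is symmetric. -/
lemma integral_mul_integral_comm (hK : IsSymmMarkovDensity μ K) {f g : X → ℝ} (hfm : Measurable f)
    (hf : ∀ᵐ x ∂μ, ‖f x‖ ≤ 1) (hgm : Measurable g) (hg : ∀ᵐ x ∂μ, ‖g x‖ ≤ 1) :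
    ∫ x, f x * ∫ y, g y * K x y ∂μ ∂μ = ∫ x, g x * ∫ y, f y * K x y ∂μ ∂μ := by
  have hint : Integrable (Function.uncurry fun x y => f x * (g y * K x y)) (μ.prod μ) := by
    refine hK.integrable_uncurry.mono' ((hfm.comp measurable_fst).mul
      ((hgm.comp measurable_snd).mul hK.measurable)).aestronglyMeasurable ?_
    filter_upwards [Measure.quasiMeasurePreserving_fst.ae hf,
      Measure.quasiMeasurePreserving_snd.ae hg] with p hp hq
    simp only [Function.uncurry, norm_mul]
    rw [Real.norm_of_nonneg (hK.nonneg _ _)]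
    have hKp := hK.nonneg p.1 p.2
    exact (mul_le_of_le_one_left (by positivity) hp).trans (mul_le_of_le_one_left hKp hq)
  simp only [← integral_const_mul]
  rw [integral_integral_swap hint]
  refine integral_congr_ae (ae_of_all _ fun y => integral_congr_ae (ae_of_all _ fun x => ?_))
  simp only [hK.symm x y]
  ring

/-- The bilinear form of a square-integrable density is continuous along weakly convergent
sequences of fractional partitions. -/
lemma tendsto_integral_mul_integral (hK : IsSymmMarkovDensity μ K) {f g : ℕ → X → ℝ}
    {f₀ g₀ : X → ℝ} (hfm : ∀ k, Measurable (f k)) (hf : ∀ k, ∀ᵐ x ∂μ, ‖f k x‖ ≤ 1)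
    (hgm : ∀ k, Measurable (g k)) (hg : ∀ k, ∀ᵐ x ∂μ, ‖g k x‖ ≤ 1)
    (hg₀m : Measurable g₀) (hg₀ : ∀ᵐ x ∂μ, ‖g₀ x‖ ≤ 1)
    (hflim : ∀ v, MemLp v 2 μ →
      Tendsto (fun k => ∫ x, f k x * v x ∂μ) atTop (𝓝 (∫ x, f₀ x * v x ∂μ)))
    (hglim : ∀ v, MemLp v 2 μ →
      Tendsto (fun k => ∫ x, g k x * v x ∂μ) atTop (𝓝 (∫ x, g₀ x * v x ∂μ))) :
    Tendsto (fun k => ∫ x, f k x * ∫ y, g k y * K x y ∂μ ∂μ) atTop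
      (𝓝 (∫ x, f₀ x * ∫ y, g₀ y * K x y ∂μ ∂μ)) := by
  have hTg := fun k => hK.memLp_integral (hgm k) (hg k) 1
  have hTg₀ := hK.memLp_integral hg₀m hg₀ 1
  have hdiff : Tendsto
      (fun k => ∫ x, f k x * ((∫ y, g k y * K x y ∂μ) - ∫ y, g₀ y * K x y ∂μ) ∂μ)
      atTop (𝓝 (∫ _x, (0 : ℝ) ∂μ)) := by
    refine tendsto_integral_of_dominated_convergence (fun _ => 2) (fun k => ?_)
      (integrable_const _) (fun k => ?_) ?_
    · exact (hfm k).aestronglyMeasurable.mul ((hTg k).sub hTg₀).aestronglyMeasurable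
    · filter_upwards [hf k] with x hx
      rw [norm_mul]
      have hsub := (norm_sub_le _ _).trans (add_le_add (hK.norm_integral_le_one (hg k) x)
        (hK.norm_integral_le_one hg₀ x))
      exact (mul_le_of_le_one_left (norm_nonneg _) hx).trans (hsub.trans_eq one_add_one_eq_two)
    · filter_upwards [ae_all_iff.2 hf] with x hx
      have hlim := (hglim (K x) (hK.memLp x)).sub_const (∫ y, g₀ y * K x y ∂μ)
      rw [sub_self] at hlim
      refine squeeze_zero_norm (fun k => ?_) (tendsto_zero_iff_norm_tendsto_zero.1 hlim)
      rw [norm_mul]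
      exact mul_le_of_le_one_left (norm_nonneg _) (hx k)
  have hfix := hflim _ (hK.memLp_integral hg₀m hg₀ 2)
  have hsum := hdiff.add hfix
  rw [integral_zero, zero_add] at hsum
  refine hsum.congr fun k => ?_
  have hint : ∀ {u : X → ℝ}, MemLp u 1 μ → Integrable (fun x => f k x * u x) μ := fun hu =>
    (memLp_one_iff_integrable.1 hu).bdd_mul (hfm k).aestronglyMeasurable (hf k)
  simp only [mul_sub]
  rw [integral_sub (hint (hTg k)) (hint hTg₀), sub_add_cancel]

/-- Among pairs of fractional partitions, the bilinear form has a minimizer. -/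
lemma exists_min_fractionalPartition [IsSeparable μ] (hK : IsSymmMarkovDensity μ K)
    (ha : ∀ i, 0 < a i) (hsum : ∑ i, a i = 1) :
    ∃ f g, IsFractionalPartition μ a f ∧ IsFractionalPartition μ a g ∧
      ∀ f' g', IsFractionalPartition μ a f' → IsFractionalPartition μ a g' →
        ∑ i, ∫ x, f i x * ∫ y, g i y * K x y ∂μ ∂μ
          ≤ ∑ i, ∫ x, f' i x * ∫ y, g' i y * K x y ∂μ ∂μ := by
  classical
  let C : (ι → X → ℝ) → (ι → X → ℝ) → ℝ := fun f g =>
    ∑ i, ∫ x, f i x * ∫ y, g i y * K x y ∂μ ∂μ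
  let S : Set ℝ := {c | ∃ f g, IsFractionalPartition μ a f ∧ IsFractionalPartition μ a g ∧ C f g = c}
  have hS : S.Nonempty := ⟨_, _, _, .const ha hsum, .const ha hsum, rfl⟩
  have hbdd : BddBelow S := by
    refine ⟨0, ?_⟩
    rintro _ ⟨f, g, hf, hg, rfl⟩
    refine Finset.sum_nonneg fun i _ => integral_nonneg_of_ae ?_
    filter_upwards [hf.nonneg i] with x hx
    refine mul_nonneg hx (integral_nonneg_of_ae ?_)
    filter_upwards [hg.nonneg i] with y hy using mul_nonneg hy (hK.nonneg x y)
  obtain ⟨c, -, hclim, hc⟩ := exists_seq_tendsto_sInf hS hbdd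
  choose f g hf hg hfg using hc
  obtain ⟨f₀, hf₀, σ, hσ, hflim⟩ := exists_subseq_tendsto_isFractionalPartition hf
  obtain ⟨g₀, hg₀, τ, hτ, hglim⟩ :=
    exists_subseq_tendsto_isFractionalPartition fun k => hg (σ k)
  have hlim : Tendsto (fun k => C (f (σ (τ k))) (g (σ (τ k)))) atTop (𝓝 (C f₀ g₀)) :=
    tendsto_finsetSum _ fun i _ => hK.tendsto_integral_mul_integral
      (fun k => (hf _).measurable i) (fun k => (hf _).norm_le_one i)
      (fun k => (hg _).measurable i) (fun k => (hg _).norm_le_one i)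
      (hg₀.measurable i) (hg₀.norm_le_one i)
      (fun v hv => (hflim i v hv).comp hτ.tendsto_atTop) (hglim i)
  have hmin : C f₀ g₀ = sInf S := tendsto_nhds_unique hlim <| by
    simp only [hfg]
    exact hclim.comp (hσ.comp hτ).tendsto_atTop
  exact ⟨f₀, g₀, hf₀, hg₀, fun f' g' hf' hg' =>
    hmin.trans_le (csInf_le hbdd ⟨f', g', hf', hg', rfl⟩)⟩

/-- On a diffuse space, the bilinear form of a symmetric density is minimized, among pairs of
fractional partitions, by a pair of genuine partitions. -/
lemma exists_min_partition [IsSeparable μ] (hK : IsSymmMarkovDensity μ K)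
    (ha : ∀ i, 0 < a i) (hsum : ∑ i, a i = 1) {ψ : X → ℝ} (hψ : Measurable ψ)
    (hψ01 : ∀ x, ψ x ∈ Icc (0 : ℝ) 1) (hψc : ∀ c, μ (ψ ⁻¹' {c}) = 0) :
    ∃ Ω Ω' : ι → Set X,
      (∀ i, MeasurableSet (Ω i)) ∧ (∀ i, MeasurableSet (Ω' i)) ∧
      (∀ i j, i ≠ j → Ω i ∩ Ω j = ∅) ∧ (∀ i j, i ≠ j → Ω' i ∩ Ω' j = ∅) ∧
      (⋃ i, Ω i) = univ ∧ (⋃ i, Ω' i) = univ ∧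
      (∀ i, μ (Ω i) = ENNReal.ofReal (a i)) ∧ (∀ i, μ (Ω' i) = ENNReal.ofReal (a i)) ∧
      ∀ f g, IsFractionalPartition μ a f → IsFractionalPartition μ a g →
        ∑ i, ∫ x, (Ω i).indicator (fun _ => (1 : ℝ)) x *
            ∫ y, (Ω' i).indicator (fun _ => (1 : ℝ)) y * K x y ∂μ ∂μ
          ≤ ∑ i, ∫ x, f i x * ∫ y, g i y * K x y ∂μ ∂μ := by
  classical
  obtain ⟨f, g, hf, hg, hmin⟩ := hK.exists_min_fractionalPartition ha hsum
  obtain ⟨Ω, hΩm, hΩd, hΩu, hΩa, hΩle⟩ := hf.exists_partition_le hψ hψ01 hψc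
    fun i => hK.memLp_integral (hg.measurable i) (hg.norm_le_one i) 2
  have hΩ := IsFractionalPartition.of_partition ha hΩm hΩd hΩu hΩa
  obtain ⟨Ω', hΩ'm, hΩ'd, hΩ'u, hΩ'a, hΩ'le⟩ := hg.exists_partition_le hψ hψ01 hψc
    fun i => hK.memLp_integral (hΩ.measurable i) (hΩ.norm_le_one i) 2
  have hΩ' := IsFractionalPartition.of_partition ha hΩ'm hΩ'd hΩ'u hΩ'a
  have hcomm : ∀ {u v : ι → X → ℝ}, IsFractionalPartition μ a u → IsFractionalPartition μ a v →
      ∑ i, ∫ x, u i x * ∫ y, v i y * K x y ∂μ ∂μ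
        = ∑ i, ∫ x, v i x * ∫ y, u i y * K x y ∂μ ∂μ := fun hu hv =>
    Finset.sum_congr rfl fun i _ => hK.integral_mul_integral_comm (hu.measurable i)
      (hu.norm_le_one i) (hv.measurable i) (hv.norm_le_one i)
  refine ⟨Ω, Ω', hΩm, hΩ'm, hΩd, hΩ'd, hΩu, hΩ'u, hΩa, hΩ'a, fun f' g' hf' hg' => ?_⟩
  calc _ = _ := hcomm hΩ hΩ'
    _ ≤ _ := hΩ'le
    _ = _ := hcomm hg hΩ
    _ ≤ _ := hΩle
    _ ≤ _ := hmin f' g' hf' hg'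

end IsSymmMarkovDensity

end SymmetricMarkovDensity

section Gaussian

open Set
open scoped ENNReal InnerProductSpace

variable {n : ℕ}

lemma continuous_gaussianDensity : Continuous (gaussianDensity n) := by
  unfold gaussianDensity
  fun_prop

lemma gaussianDensity_pos (x : EuclideanSpace ℝ (Fin n)) : 0 < gaussianDensity n x := by
  unfold gaussianDensity
  positivity

lemma integral_gaussianMeasure (f : EuclideanSpace ℝ (Fin n) → ℝ) :
    ∫ x, f x ∂(gaussianMeasure n) = ∫ x, gaussianDensity n x * f x := by
  rw [gaussianMeasure, integral_withDensity_eq_integral_toReal_smul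
    continuous_gaussianDensity.measurable.ennreal_ofReal (by simp)]
  simp [ENNReal.toReal_ofReal (gaussianDensity_pos _).le]

lemma integrable_gaussianMeasure_iff {f : EuclideanSpace ℝ (Fin n) → ℝ} :
    Integrable f (gaussianMeasure n) ↔ Integrable (fun x => gaussianDensity n x * f x) := by
  rw [gaussianMeasure, integrable_withDensity_iff_integrable_smul'
    continuous_gaussianDensity.measurable.ennreal_ofReal (by simp)]
  simp [ENNReal.toReal_ofReal (gaussianDensity_pos _).le]

lemma integrable_exp_neg_mul_sq_norm_add {b : ℝ} (hb : 0 < b) (w : EuclideanSpace ℝ (Fin n)) :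
    Integrable fun v : EuclideanSpace ℝ (Fin n) => Real.exp (-b * ‖v‖ ^ 2 + ⟪w, v⟫_ℝ) := by
  have h := (GaussianFourier.integrable_cexp_neg_mul_sq_norm_add (V := EuclideanSpace ℝ (Fin n))
    (b := (b : ℂ)) (by simpa using hb) 1 w).re
  refine h.congr (ae_of_all _ fun v => ?_)
  have : (-(b : ℂ) * (‖v‖ : ℂ) ^ 2 + 1 * ((⟪w, v⟫_ℝ : ℝ) : ℂ))
      = ((-b * ‖v‖ ^ 2 + ⟪w, v⟫_ℝ : ℝ) : ℂ) := by
    push_cast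
    ring
  simp only [this, ← Complex.ofReal_exp]
  exact Complex.ofReal_re _

lemma integral_gaussianDensity : ∫ x, gaussianDensity n x = 1 := by
  have h := GaussianFourier.integral_rexp_neg_mul_sq_norm (V := EuclideanSpace ℝ (Fin n))
    (b := 1 / 2) (by norm_num)
  simp only [gaussianDensity, integral_const_mul]
  have hexp : ∀ x : EuclideanSpace ℝ (Fin n), -‖x‖ ^ 2 / 2 = -(1 / 2) * ‖x‖ ^ 2 := fun x => by ring
  simp only [hexp]
  rw [h, finrank_euclideanSpace_fin, show Real.pi / (1 / 2) = 2 * Real.pi by ring,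
    ← Real.rpow_add (by positivity), neg_div, neg_add_cancel, Real.rpow_zero]

lemma integrable_gaussianDensity : Integrable (gaussianDensity n) :=
  Integrable.of_integral_ne_zero (by rw [integral_gaussianDensity]; exact one_ne_zero)

instance : IsProbabilityMeasure (gaussianMeasure n) := ⟨by
  rw [gaussianMeasure, withDensity_apply _ MeasurableSet.univ, setLIntegral_univ,
    ← ofReal_integral_eq_lintegral_ofReal integrable_gaussianDensity
      (ae_of_all _ fun x => (gaussianDensity_pos x).le), integral_gaussianDensity,
    ENNReal.ofReal_one]⟩

lemma gaussianMeasure_exp_neg_norm_preimage (c : ℝ) :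
    gaussianMeasure (n + 1) ((fun x => Real.exp (-‖x‖)) ⁻¹' {c}) = 0 := by
  refine withDensity_absolutelyContinuous _ _ (measure_mono_null (t := Metric.sphere 0 (-Real.log c))
    (fun x hx => ?_) (Measure.addHaar_sphere _ _ _))
  rw [mem_preimage, mem_singleton_iff] at hx
  rw [mem_sphere_zero_iff_norm, ← hx, Real.log_exp, neg_neg]

/-- The Mehler kernel: the density of the Ornstein-Uhlenbeck operator with respect to the Gaussian
measure. -/
noncomputable def mehlerKernel (n : ℕ) (ρ : ℝ) (x z : EuclideanSpace ℝ (Fin n)) : ℝ :=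
  (Real.sqrt (1 - ρ ^ 2) ^ n)⁻¹ *
    Real.exp ((2 * ρ * ⟪x, z⟫_ℝ - ρ ^ 2 * (‖x‖ ^ 2 + ‖z‖ ^ 2)) / (2 * (1 - ρ ^ 2)))

variable {ρ : ℝ}

lemma one_sub_sq_pos (hρ : ρ ∈ Ioo (0 : ℝ) 1) : 0 < 1 - ρ ^ 2 := by
  nlinarith [hρ.1, hρ.2]

lemma gaussianDensity_mul_mehlerKernel (hρ : ρ ∈ Ioo (0 : ℝ) 1)
    (x z : EuclideanSpace ℝ (Fin n)) :
    gaussianDensity n z * mehlerKernel n ρ x z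
      = (Real.sqrt (1 - ρ ^ 2) ^ n)⁻¹ *
        gaussianDensity n ((Real.sqrt (1 - ρ ^ 2))⁻¹ • (z - ρ • x)) := by
  have hpos := one_sub_sq_pos hρ
  have hnorm : ‖(Real.sqrt (1 - ρ ^ 2))⁻¹ • (z - ρ • x)‖ ^ 2
      = (‖z‖ ^ 2 - 2 * ρ * ⟪x, z⟫_ℝ + ρ ^ 2 * ‖x‖ ^ 2) / (1 - ρ ^ 2) := by
    rw [norm_smul, mul_pow, norm_inv, inv_pow, Real.norm_of_nonneg (Real.sqrt_nonneg _),
      Real.sq_sqrt hpos.le, norm_sub_sq_real, inner_smul_right, norm_smul, mul_pow,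
      Real.norm_of_nonneg hρ.1.le, real_inner_comm]
    field_simp
  simp only [gaussianDensity, mehlerKernel, hnorm]
  rw [mul_mul_mul_comm, mul_left_comm ((Real.sqrt (1 - ρ ^ 2) ^ n)⁻¹), ← Real.exp_add, mul_assoc]
  congr 3
  field_simp
  ring

lemma ouOp_eq_integral_mehlerKernel (hρ : ρ ∈ Ioo (0 : ℝ) 1)
    (f : EuclideanSpace ℝ (Fin n) → ℝ) (x : EuclideanSpace ℝ (Fin n)) :
    ouOp n ρ f x = ∫ z, f z * mehlerKernel n ρ x z ∂(gaussianMeasure n) := by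
  have hs : 0 < Real.sqrt (1 - ρ ^ 2) := Real.sqrt_pos.2 (one_sub_sq_pos hρ)
  set s := Real.sqrt (1 - ρ ^ 2) with hsdef
  rw [ouOp, integral_gaussianMeasure, integral_gaussianMeasure, ← hsdef]
  have hscale := Measure.integral_comp_smul volume
    (fun z => gaussianDensity n (s⁻¹ • z) * f (ρ • x + z)) s
  simp only [inv_smul_smul₀ hs.ne', finrank_euclideanSpace_fin] at hscale
  rw [hscale, abs_of_pos (by positivity), smul_eq_mul, ← integral_const_mul]
  rw [← integral_add_left_eq_self
    (fun z => gaussianDensity n z * (f z * mehlerKernel n ρ x z)) (ρ • x)]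
  refine integral_congr_ae (ae_of_all _ fun z => ?_)
  simp only
  rw [mul_left_comm (gaussianDensity n (ρ • x + z)), gaussianDensity_mul_mehlerKernel hρ,
    add_sub_cancel_left]
  ring

lemma isSymmMarkovDensity_mehlerKernel (hρ : ρ ∈ Ioo (0 : ℝ) 1) :
    IsSymmMarkovDensity (gaussianMeasure n) (mehlerKernel n ρ) where
  measurable := by
    refine Continuous.measurable ?_
    unfold mehlerKernel
    fun_prop
  nonneg x z := by
    unfold mehlerKernel
    positivity
  symm x z := by
    simp only [mehlerKernel, real_inner_comm, add_comm]
  memLp x := by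
    have hpos := one_sub_sq_pos hρ
    have hcont : Continuous (mehlerKernel n ρ x) := by
      unfold mehlerKernel
      fun_prop
    rw [memLp_two_iff_integrable_sq hcont.aestronglyMeasurable, integrable_gaussianMeasure_iff]
    have hb : 0 < 1 / 2 + ρ ^ 2 / (1 - ρ ^ 2) := by positivity
    refine ((integrable_exp_neg_mul_sq_norm_add hb ((2 * ρ / (1 - ρ ^ 2)) • x)).const_mul
      ((2 * Real.pi) ^ (-(n : ℝ) / 2) * (Real.sqrt (1 - ρ ^ 2) ^ n)⁻¹ ^ 2 *
        Real.exp (-(ρ ^ 2 * ‖x‖ ^ 2) / (1 - ρ ^ 2)))).congr (ae_of_all _ fun z => ?_)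
    simp only [gaussianDensity, mehlerKernel, mul_pow, ← Real.exp_nat_mul]
    rw [mul_mul_mul_comm _ (Real.exp (-‖z‖ ^ 2 / 2)), mul_assoc (_ * _) (Real.exp _) (Real.exp _),
      ← Real.exp_add, ← Real.exp_add, inner_smul_left]
    congr 2
    simp only [conj_trivial]
    push_cast
    field_simp
    ring
  integral_eq_one x := by
    have h := ouOp_eq_integral_mehlerKernel hρ (fun _ => (1 : ℝ)) x
    simpa [ouOp] using h.symm

end Gaussian

/-- existence of a pair of Gaussian-volume-constrained partitions
minimizing the bilinear noise stability `Σ_i ∫ 1_{Ω_i} T_ρ 1_{Ω'_i} dγ`. -/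
theorem exists_min_bilinear_noise_stable_partitions (n m : ℕ) (hm : 2 ≤ m)
    (ρ : ℝ) (hρ : ρ ∈ Set.Ioo (0 : ℝ) 1)
    (a : Fin m → ℝ) (ha : ∀ i, 0 < a i) (hsum : ∑ i, a i = 1) :
    ∃ Ω Ω' : Fin m → Set (EuclideanSpace ℝ (Fin (n + 1))),
      (∀ i, MeasurableSet (Ω i)) ∧ (∀ i, MeasurableSet (Ω' i)) ∧
      (∀ i j, i ≠ j → Ω i ∩ Ω j = ∅) ∧ (∀ i j, i ≠ j → Ω' i ∩ Ω' j = ∅) ∧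
      (⋃ i, Ω i) = Set.univ ∧ (⋃ i, Ω' i) = Set.univ ∧
      (∀ i, gaussianMeasure (n + 1) (Ω i) = ENNReal.ofReal (a i)) ∧
      (∀ i, gaussianMeasure (n + 1) (Ω' i) = ENNReal.ofReal (a i)) ∧
      (∀ Θ Θ' : Fin m → Set (EuclideanSpace ℝ (Fin (n + 1))),
        (∀ i, MeasurableSet (Θ i)) → (∀ i, MeasurableSet (Θ' i)) →
        (∀ i j, i ≠ j → Θ i ∩ Θ j = ∅) → (∀ i j, i ≠ j → Θ' i ∩ Θ' j = ∅) →
        (⋃ i, Θ i) = Set.univ → (⋃ i, Θ' i) = Set.univ →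
        (∀ i, gaussianMeasure (n + 1) (Θ i) = ENNReal.ofReal (a i)) →
        (∀ i, gaussianMeasure (n + 1) (Θ' i) = ENNReal.ofReal (a i)) →
        ∑ i, ∫ x, Set.indicator (Ω i) (fun _ => (1 : ℝ)) x
            * ouOp (n + 1) ρ (Set.indicator (Ω' i) (fun _ => (1 : ℝ))) x
            ∂(gaussianMeasure (n + 1))
          ≤ ∑ i, ∫ x, Set.indicator (Θ i) (fun _ => (1 : ℝ)) x
            * ouOp (n + 1) ρ (Set.indicator (Θ' i) (fun _ => (1 : ℝ))) x
            ∂(gaussianMeasure (n + 1))) := by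
  obtain ⟨Ω, Ω', hΩ, hΩ', hd, hd', hu, hu', hmass, hmass', hmin⟩ :=
    (isSymmMarkovDensity_mehlerKernel (n := n + 1) hρ).exists_min_partition ha hsum
      (ψ := fun x => Real.exp (-‖x‖)) (by fun_prop)
      (fun x => ⟨(Real.exp_pos _).le, Real.exp_le_one_iff.2 (neg_nonpos.2 (norm_nonneg x))⟩)
      gaussianMeasure_exp_neg_norm_preimage
  refine ⟨Ω, Ω', hΩ, hΩ', hd, hd', hu, hu', hmass, hmass', ?_⟩
  intro Θ Θ' hΘ hΘ' hΘd hΘd' hΘu hΘu' hΘm hΘm'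
  simp only [ouOp_eq_integral_mehlerKernel hρ]
  exact hmin _ _ (.of_partition ha hΘ hΘd hΘu hΘm) (.of_partition ha hΘ' hΘd' hΘu' hΘm')
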